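/- arXiv:2502.18839 — 2 statements merged into one kernel-verified Lean document; each statement's English description precedes it below -/
import Mathlib

section
/- Let λ, β ∈ ℝ^{n_d} and γ ∈ ℝ^{n_s} be nonnegative, let 0 < ρ ≤ 1 with λ_i + ρ·β_i > 0 for every i, suppose v_{i,j} > 0 for all i,j, and let 0 ≤ κ < min_{i,j} v_{i,j}. Let x be a v-optimal solution for (λ + ρβ, γ), and define v̄_i = (Σ_{j} v_{i,j} x_{i,j}) / (λ_i + ρβ_i) and the matching rates x̄_i = (Σ_j x_{i,j}) / (λ_i + ρβ_i). Let v−κ denote the weight matrix with entries v_{i,j} − κ. Then the fixed-cost global treatment effect is overestimated by the cost-excluded RCT estimator: Φ_{v−κ}(λ+β, γ) − Φ_v(λ, γ) ≤ Σ_i (v̄_i − κ·x̄_i)(λ_i + β_i) − Σ_i v̄_i λ_i. -/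
/-- A matrix `x` is CE-feasible for demand `d` and supply `s`. -/
def CEfeasible {nd ns : ℕ} (d : Fin nd → ℝ) (s : Fin ns → ℝ)
    (x : Fin nd → Fin ns → ℝ) : Prop :=
  (∀ i j, 0 ≤ x i j) ∧ (∀ i, ∑ j, x i j ≤ d i) ∧ (∀ j, ∑ i, x i j ≤ s j)

/-- The cost-excluded matching value `Φ_w(d,s)`. -/
noncomputable def Phi {nd ns : ℕ} (w : Fin nd → Fin ns → ℝ)
    (d : Fin nd → ℝ) (s : Fin ns → ℝ) : ℝ :=
  sSup {z : ℝ | ∃ x, CEfeasible d s x ∧ z = ∑ i, ∑ j, w i j * x i j}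

/-- `x` is a `w`-optimal solution for `(d,s)`. -/
def IsOptimal {nd ns : ℕ} (w : Fin nd → Fin ns → ℝ)
    (d : Fin nd → ℝ) (s : Fin ns → ℝ) (x : Fin nd → Fin ns → ℝ) : Prop :=
  CEfeasible d s x ∧ ∑ i, ∑ j, w i j * x i j = Phi w d s

/-- `(a,b)` is a `w`-optimal dual for `(d,s)`. -/
def IsOptimalDual {nd ns : ℕ} (w : Fin nd → Fin ns → ℝ)
    (d : Fin nd → ℝ) (s : Fin ns → ℝ) (a : Fin nd → ℝ) (b : Fin ns → ℝ) : Prop :=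
  (∀ i, 0 ≤ a i) ∧ (∀ j, 0 ≤ b j) ∧ (∀ i j, w i j ≤ a i + b j) ∧
  (∑ i, a i * d i) + (∑ j, b j * s j) = Phi w d s

theorem CEfeasible.zero {nd ns : ℕ} {d : Fin nd → ℝ} {s : Fin ns → ℝ}
    (hd : ∀ i, 0 ≤ d i) (hs : ∀ j, 0 ≤ s j) : CEfeasible d s (fun _ _ => 0) := by
  simp [CEfeasible, hd, hs]

theorem CEfeasible.value_le_Phi {nd ns : ℕ} {d : Fin nd → ℝ} {s : Fin ns → ℝ}
    {x : Fin nd → Fin ns → ℝ} (w : Fin nd → Fin ns → ℝ) (hx : CEfeasible d s x) :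
    ∑ i, ∑ j, w i j * x i j ≤ Phi w d s := by
  refine le_csSup ⟨∑ i, ∑ j, |w i j| * s j, ?_⟩ ⟨x, hx, rfl⟩
  rintro z ⟨y, ⟨h0, -, hcol⟩, rfl⟩
  refine Finset.sum_le_sum fun i _ => Finset.sum_le_sum fun j _ => ?_
  have hy : y i j ≤ s j :=
    (Finset.single_le_sum (fun k _ => h0 k j) (Finset.mem_univ i)).trans (hcol j)
  exact (mul_le_mul_of_nonneg_right (le_abs_self _) (h0 i j)).trans
    (mul_le_mul_of_nonneg_left hy (abs_nonneg _))

theorem Phi_le {nd ns : ℕ} {w : Fin nd → Fin ns → ℝ} {d : Fin nd → ℝ} {s : Fin ns → ℝ} {B : ℝ}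
    (hd : ∀ i, 0 ≤ d i) (hs : ∀ j, 0 ≤ s j)
    (h : ∀ y, CEfeasible d s y → ∑ i, ∑ j, w i j * y i j ≤ B) : Phi w d s ≤ B := by
  refine csSup_le ⟨_, _, CEfeasible.zero hd hs, rfl⟩ ?_
  rintro z ⟨y, hy, rfl⟩
  exact h y hy

/-- Every feasible matrix lies below a feasible matrix of maximal total mass. -/
theorem CEfeasible.exists_saturated {nd ns : ℕ} {d : Fin nd → ℝ} {s : Fin ns → ℝ}
    {z : Fin nd → Fin ns → ℝ} (hz : CEfeasible d s z) :
    ∃ y, CEfeasible d s y ∧ (∀ i j, z i j ≤ y i j) ∧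
      ∑ i, ∑ j, y i j = min (∑ i, d i) (∑ j, s j) := by
  obtain ⟨h0, hrow, hcol⟩ := hz
  set p : Fin nd → ℝ := fun i => d i - ∑ j, z i j with hp
  set q : Fin ns → ℝ := fun j => s j - ∑ i, z i j with hq
  have hp0 : ∀ i, 0 ≤ p i := fun i => sub_nonneg.2 (hrow i)
  have hq0 : ∀ j, 0 ≤ q j := fun j => sub_nonneg.2 (hcol j)
  set P := ∑ i, p i with hP
  set Q := ∑ j, q j with hQ
  have hP0 : 0 ≤ P := Finset.sum_nonneg fun i _ => hp0 i
  have hQ0 : 0 ≤ Q := Finset.sum_nonneg fun j _ => hq0 j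
  have hM0 : 0 ≤ max P Q := le_max_of_le_left hP0
  have hadd : ∀ i j, 0 ≤ p i * q j / max P Q := fun i j =>
    div_nonneg (mul_nonneg (hp0 i) (hq0 j)) hM0
  have hrow_add : ∀ i, ∑ j, p i * q j / max P Q = p i * (Q / max P Q) := fun i => by
    rw [← Finset.sum_div, ← Finset.mul_sum, mul_div_assoc]
  have hcol_add : ∀ j, ∑ i, p i * q j / max P Q = q j * (P / max P Q) := fun j => by
    rw [← Finset.sum_div, ← Finset.sum_mul, mul_comm, mul_div_assoc]
  refine ⟨fun i j => z i j + p i * q j / max P Q,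
    ⟨fun i j => add_nonneg (h0 i j) (hadd i j), fun i => ?_, fun j => ?_⟩,
    fun i j => le_add_of_nonneg_right (hadd i j), ?_⟩
  · rw [Finset.sum_add_distrib, hrow_add]
    have := mul_le_of_le_one_right (hp0 i) (div_le_one_of_le₀ (le_max_right P Q) hM0)
    simp only [hp] at this ⊢
    linarith
  · rw [Finset.sum_add_distrib, hcol_add]
    have := mul_le_of_le_one_right (hq0 j) (div_le_one_of_le₀ (le_max_left P Q) hM0)
    simp only [hq] at this ⊢
    linarith
  · have hPz : ∑ i, d i = P + ∑ i, ∑ j, z i j := by simp [hP, hp]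
    have hQz : ∑ j, s j = Q + ∑ i, ∑ j, z i j := by
      rw [Finset.sum_comm]; simp [hQ, hq]
    have hPQ : P * (Q / max P Q) = min P Q := by
      rcases hM0.eq_or_lt with h | h
      · have h1 : P = 0 := le_antisymm (h ▸ le_max_left P Q) hP0
        have h2 : Q = 0 := le_antisymm (h ▸ le_max_right P Q) hQ0
        simp [h1, h2]
      · rw [← mul_div_assoc, div_eq_iff h.ne', min_mul_max]
    simp only [Finset.sum_add_distrib, hrow_add, ← Finset.sum_mul]
    rw [← hP, hPQ, hPz, hQz, min_add_add_right, add_comm]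

theorem CEfeasible.mass_le {nd ns : ℕ} {d : Fin nd → ℝ} {s : Fin ns → ℝ}
    {x : Fin nd → Fin ns → ℝ} (hx : CEfeasible d s x) :
    ∑ i, ∑ j, x i j ≤ min (∑ i, d i) (∑ j, s j) := by
  refine le_min (Finset.sum_le_sum fun i _ => hx.2.1 i) ?_
  rw [Finset.sum_comm]
  exact Finset.sum_le_sum fun j _ => hx.2.2 j

/-- Lowering all weights by a constant below the smallest weight preserves optimality. -/
theorem IsOptimal.value_sub_const_le {nd ns : ℕ} {v : Fin nd → Fin ns → ℝ}
    {d : Fin nd → ℝ} {s : Fin ns → ℝ} {x z : Fin nd → Fin ns → ℝ} {kappa : ℝ}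
    (hx : IsOptimal v d s x) (hkappa0 : 0 ≤ kappa) (hkappa : ∀ i j, kappa ≤ v i j)
    (hz : CEfeasible d s z) :
    ∑ i, ∑ j, (v i j - kappa) * z i j ≤ ∑ i, ∑ j, (v i j - kappa) * x i j := by
  obtain ⟨y, hy, hzy, hmass⟩ := hz.exists_saturated
  have hsplit : ∀ u : Fin nd → Fin ns → ℝ, ∑ i, ∑ j, (v i j - kappa) * u i j =
      ∑ i, ∑ j, v i j * u i j - kappa * ∑ i, ∑ j, u i j := fun u => by
    simp only [sub_mul, Finset.sum_sub_distrib, Finset.mul_sum]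
  calc ∑ i, ∑ j, (v i j - kappa) * z i j ≤ ∑ i, ∑ j, (v i j - kappa) * y i j :=
        Finset.sum_le_sum fun i _ => Finset.sum_le_sum fun j _ =>
          mul_le_mul_of_nonneg_left (hzy i j) (sub_nonneg.2 (hkappa i j))
    _ ≤ ∑ i, ∑ j, (v i j - kappa) * x i j := by
        rw [hsplit, hsplit, hx.2, hmass]
        exact sub_le_sub (hy.value_le_Phi v) (mul_le_mul_of_nonneg_left hx.1.mass_le hkappa0)

/-- Scaling the rows of an optimal solution by factors `r i ≥ 1` bounds the matching values
attainable with the demands scaled by `r`. -/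
theorem CEfeasible.value_le_scaled_value {nd ns : ℕ} {w : Fin nd → Fin ns → ℝ}
    {d r : Fin nd → ℝ} {s : Fin ns → ℝ} {x y : Fin nd → Fin ns → ℝ}
    (hx : CEfeasible d s x)
    (hopt : ∀ z, CEfeasible d s z → ∑ i, ∑ j, w i j * z i j ≤ ∑ i, ∑ j, w i j * x i j)
    (hr : ∀ i, 1 ≤ r i) (hy : CEfeasible (fun i => r i * d i) s y) :
    ∑ i, ∑ j, w i j * y i j ≤ ∑ i, r i * ∑ j, w i j * x i j := by
  have hr0 : ∀ i, 0 ≤ r i := fun i => zero_le_one.trans (hr i)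
  have hR0 : 0 ≤ ∑ i, r i := Finset.sum_nonneg fun i _ => hr0 i
  obtain ⟨e, he0, he1, her⟩ : ∃ e : ℝ, 0 < e ∧ e ≤ 1 ∧ ∀ i, e * r i ≤ 1 := by
    refine ⟨1 / (1 + ∑ i, r i), by positivity, ?_, fun i => ?_⟩
    · rw [div_le_one (by positivity)]; linarith
    · have := Finset.single_le_sum (fun k _ => hr0 k) (Finset.mem_univ i)
      rw [div_mul_eq_mul_div, div_le_one (by positivity)]; linarith
  have hfeas : CEfeasible d s (fun i j => (1 - e * r i) * x i j + e * y i j) := by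
    refine ⟨fun i j => add_nonneg (mul_nonneg (sub_nonneg.2 (her i)) (hx.1 i j))
      (mul_nonneg he0.le (hy.1 i j)), fun i => ?_, fun j => ?_⟩
    · rw [Finset.sum_add_distrib, ← Finset.mul_sum, ← Finset.mul_sum]
      have h1 := mul_le_mul_of_nonneg_left (hx.2.1 i) (sub_nonneg.2 (her i))
      have h2 := mul_le_mul_of_nonneg_left (hy.2.1 i) he0.le
      linarith
    · have h1 : ∑ i, (1 - e * r i) * x i j ≤ ∑ i, (1 - e) * x i j :=
        Finset.sum_le_sum fun i _ => mul_le_mul_of_nonneg_right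
          (sub_le_sub_left (le_mul_of_one_le_right he0.le (hr i)) 1) (hx.1 i j)
      rw [← Finset.mul_sum] at h1
      rw [Finset.sum_add_distrib, ← Finset.mul_sum]
      have h2 := mul_le_mul_of_nonneg_left (hx.2.2 j) (sub_nonneg.2 he1)
      have h3 := mul_le_mul_of_nonneg_left (hy.2.2 j) he0.le
      linarith
  have hval := hopt _ hfeas
  have hsplit : ∑ i, ∑ j, w i j * ((1 - e * r i) * x i j + e * y i j) =
      ∑ i, ∑ j, w i j * x i j + e * (∑ i, ∑ j, w i j * y i j
        - ∑ i, r i * ∑ j, w i j * x i j) := by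
    simp only [Finset.mul_sum, mul_sub, ← Finset.sum_sub_distrib, ← Finset.sum_add_distrib]
    exact Finset.sum_congr rfl fun i _ => Finset.sum_congr rfl fun j _ => by ring
  rw [hsplit] at hval
  exact sub_nonpos.1 (nonpos_of_mul_nonpos_right (by linarith) he0)

/-- Scaling the rows of a feasible solution by factors in `[0, 1]` gives a feasible solution. -/
theorem CEfeasible.scale_rows {nd ns : ℕ} {d r : Fin nd → ℝ} {s : Fin ns → ℝ}
    {x : Fin nd → Fin ns → ℝ} (hx : CEfeasible d s x)
    (hr0 : ∀ i, 0 ≤ r i) (hr1 : ∀ i, r i ≤ 1) :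
    CEfeasible (fun i => r i * d i) s (fun i j => r i * x i j) := by
  refine ⟨fun i j => mul_nonneg (hr0 i) (hx.1 i j), fun i => ?_, fun j => ?_⟩
  · rw [← Finset.mul_sum]
    exact mul_le_mul_of_nonneg_left (hx.2.1 i) (hr0 i)
  · exact (Finset.sum_le_sum fun i _ => mul_le_of_le_one_left (hx.1 i j) (hr1 i)).trans (hx.2.2 j)

/-- the cost-excluded RCT estimator overestimates the
fixed-cost global treatment effect. -/
theorem rct_ce_overestimates_fixed (nd ns : ℕ) (hnd : 0 < nd) (hns : 0 < ns)
    (v : Fin nd → Fin ns → ℝ) (hv : ∀ i j, 0 < v i j)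
    (lam beta : Fin nd → ℝ) (gam : Fin ns → ℝ)
    (hlam : ∀ i, 0 ≤ lam i) (hbeta : ∀ i, 0 ≤ beta i) (hgam : ∀ j, 0 ≤ gam j)
    (rho : ℝ) (hrho0 : 0 < rho) (hrho1 : rho ≤ 1)
    (hpos : ∀ i, 0 < lam i + rho * beta i)
    (kappa : ℝ) (hkappa0 : 0 ≤ kappa) (hkappa : ∀ i j, kappa < v i j)
    (x : Fin nd → Fin ns → ℝ)
    (hx : IsOptimal v (fun i => lam i + rho * beta i) gam x)
    (vbar xbar : Fin nd → ℝ)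
    (hvbar : ∀ i, vbar i = (∑ j, v i j * x i j) / (lam i + rho * beta i))
    (hxbar : ∀ i, xbar i = (∑ j, x i j) / (lam i + rho * beta i)) :
    Phi (fun i j => v i j - kappa) (fun i => lam i + beta i) gam - Phi v lam gam ≤
      (∑ i, (vbar i - kappa * xbar i) * (lam i + beta i)) - ∑ i, vbar i * lam i := by
  have hlow : ∑ i, vbar i * lam i ≤ Phi v lam gam := by
    have hfeas := (hx.1.scale_rows (r := fun i => lam i / (lam i + rho * beta i))
      (fun i => div_nonneg (hlam i) (hpos i).le)
      (fun i => div_le_one_of_le₀ (le_add_of_nonneg_right (mul_nonneg hrho0.le (hbeta i)))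
        (hpos i).le))
    simp only [div_mul_cancel₀ _ (hpos _).ne'] at hfeas
    refine le_of_eq_of_le (Finset.sum_congr rfl fun i _ => ?_) (hfeas.value_le_Phi v)
    rw [hvbar, div_mul_eq_mul_div, mul_div_assoc, Finset.sum_mul]
    exact Finset.sum_congr rfl fun j _ => by ring
  have hup : Phi (fun i j => v i j - kappa) (fun i => lam i + beta i) gam ≤
      ∑ i, (vbar i - kappa * xbar i) * (lam i + beta i) := by
    refine Phi_le (fun i => add_nonneg (hlam i) (hbeta i)) hgam fun y hy => ?_
    have hscale : ∀ i, (lam i + beta i) / (lam i + rho * beta i) * (lam i + rho * beta i) =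
        lam i + beta i := fun i => div_mul_cancel₀ _ (hpos i).ne'
    refine (hx.1.value_le_scaled_value
      (r := fun i => (lam i + beta i) / (lam i + rho * beta i))
      (fun z hz => hx.value_sub_const_le hkappa0 (fun i j => (hkappa i j).le) hz)
      (fun i => (one_le_div (hpos i)).2
        (add_le_add_right (mul_le_of_le_one_left (hbeta i) hrho1) _))
      (by simpa only [hscale] using hy)).trans_eq (Finset.sum_congr rfl fun i _ => ?_)
    simp only [hvbar, hxbar, sub_mul (v i _), Finset.sum_sub_distrib, ← Finset.mul_sum]
    ring
  linarith
end

section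
/- Suppose v_{i,j} > 0 for all i,j, 0 < α < 1, v^tre = (1−α)v, and for each supply type j there is a demand type i(j) with v_{i(j),j} > v_{k,j} for every k ≠ i(j). Let λ, β ∈ ℝ^{n_d} and γ ∈ ℝ^{n_s} be nonnegative with λ_i > 0 for all i, let 0 < ρ < 1, and assume Σ_{j} γ_j < (1−ρ)·λ_i for every i. Let (x^con, x^tre) be any optimal CI-feasible solution for ((1−ρ)λ, ρ(λ+β), γ), and define the fluid-limit cost-included RCT estimator Δ̂ = (1/ρ)·Σ_{i,j} (1−α)v_{i,j} x^tre_{i,j} − (1/(1−ρ))·Σ_{i,j} v_{i,j} x^con_{i,j}, and the global treatment effect Δ = Φ_CI(0, λ+β, γ) − Φ_CI(λ, 0, γ). Then Δ = −α·Σ_j v_{i(j),j} γ_j, Δ̂ = −(1/(1−ρ))·Σ_j v_{i(j),j} γ_j, so Δ̂ − Δ = −(1/(1−ρ) − α)·Σ_j v_{i(j),j} γ_j ≤ 0; moreover if Σ_j v_{i(j),j} γ_j > 0 then the relative bias is (Δ̂ − Δ)/|Δ| = 1 − 1/(α(1−ρ)). -/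
/-- A pair `(xcon, xtre)` is CI-feasible for `(dcon, dtre, s)`. -/
def CIfeasible {nd ns : ℕ} (dcon dtre : Fin nd → ℝ) (s : Fin ns → ℝ)
    (xcon xtre : Fin nd → Fin ns → ℝ) : Prop :=
  (∀ i j, 0 ≤ xcon i j) ∧ (∀ i j, 0 ≤ xtre i j) ∧
  (∀ i, ∑ j, xcon i j ≤ dcon i) ∧ (∀ i, ∑ j, xtre i j ≤ dtre i) ∧
  (∀ j, ∑ i, (xcon i j + xtre i j) ≤ s j)

/-- The cost-included matching value `Φ_CI(dcon, dtre, s)`. -/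
noncomputable def PhiCI {nd ns : ℕ} (v vtre : Fin nd → Fin ns → ℝ)
    (dcon dtre : Fin nd → ℝ) (s : Fin ns → ℝ) : ℝ :=
  sSup {z : ℝ | ∃ xcon xtre, CIfeasible dcon dtre s xcon xtre ∧
    z = ∑ i, ∑ j, (v i j * xcon i j + vtre i j * xtre i j)}

/-- `(xcon, xtre)` is an optimal CI-feasible solution for `(dcon, dtre, s)`. -/
def CIOptimal {nd ns : ℕ} (v vtre : Fin nd → Fin ns → ℝ)
    (dcon dtre : Fin nd → ℝ) (s : Fin ns → ℝ)
    (xcon xtre : Fin nd → Fin ns → ℝ) : Prop :=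
  CIfeasible dcon dtre s xcon xtre ∧
  ∑ i, ∑ j, (v i j * xcon i j + vtre i j * xtre i j) = PhiCI v vtre dcon dtre s

/-- `(acon, atre, b)` is an optimal CI dual for `(dcon, dtre, s)`. -/
def CIOptimalDual {nd ns : ℕ} (v vtre : Fin nd → Fin ns → ℝ)
    (dcon dtre : Fin nd → ℝ) (s : Fin ns → ℝ)
    (acon atre : Fin nd → ℝ) (b : Fin ns → ℝ) : Prop :=
  (∀ i, 0 ≤ acon i) ∧ (∀ i, 0 ≤ atre i) ∧ (∀ j, 0 ≤ b j) ∧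
  (∀ i j, v i j ≤ acon i + b j) ∧ (∀ i j, vtre i j ≤ atre i + b j) ∧
  (∑ i, acon i * dcon i) + (∑ i, atre i * dtre i) + (∑ j, b j * s j) =
    PhiCI v vtre dcon dtre s

/-- Weak duality with zero demand prices: supply prices that dominate all weights bound the value. -/
theorem CIfeasible.value_le {nd ns : ℕ} {v vtre : Fin nd → Fin ns → ℝ}
    {dcon dtre : Fin nd → ℝ} {s b : Fin ns → ℝ} {xcon xtre : Fin nd → Fin ns → ℝ}
    (h : CIfeasible dcon dtre s xcon xtre) (hb : ∀ j, 0 ≤ b j)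
    (hv : ∀ i j, v i j ≤ b j) (hvtre : ∀ i j, vtre i j ≤ b j) :
    ∑ i, ∑ j, (v i j * xcon i j + vtre i j * xtre i j) ≤ ∑ j, b j * s j := by
  obtain ⟨hcon, htre, -, -, hs⟩ := h
  rw [Finset.sum_comm]
  refine Finset.sum_le_sum fun j _ => ?_
  calc ∑ i, (v i j * xcon i j + vtre i j * xtre i j)
      ≤ ∑ i, b j * (xcon i j + xtre i j) := Finset.sum_le_sum fun i _ => by
        rw [mul_add]
        exact add_le_add (mul_le_mul_of_nonneg_right (hv i j) (hcon i j))
          (mul_le_mul_of_nonneg_right (hvtre i j) (htre i j))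
    _ = b j * ∑ i, (xcon i j + xtre i j) := (Finset.mul_sum _ _ _).symm
    _ ≤ b j * s j := mul_le_mul_of_nonneg_left (hs j) (hb j)

/-- A feasible pair whose value meets the bound given by dominating supply prices attains `PhiCI`. -/
theorem PhiCI_eq_of_attained {nd ns : ℕ} {v vtre : Fin nd → Fin ns → ℝ}
    {dcon dtre : Fin nd → ℝ} {s b : Fin ns → ℝ} {xcon xtre : Fin nd → Fin ns → ℝ}
    (h : CIfeasible dcon dtre s xcon xtre) (hb : ∀ j, 0 ≤ b j)
    (hv : ∀ i j, v i j ≤ b j) (hvtre : ∀ i j, vtre i j ≤ b j)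
    (hval : ∑ i, ∑ j, (v i j * xcon i j + vtre i j * xtre i j) = ∑ j, b j * s j) :
    PhiCI v vtre dcon dtre s = ∑ j, b j * s j := by
  refine IsGreatest.csSup_eq ⟨⟨xcon, xtre, h, hval.symm⟩, ?_⟩
  rintro z ⟨ycon, ytre, hy, rfl⟩
  exact hy.value_le hb hv hvtre

/-- The assignment sending all supply of type `j` to the demand type `ic j`. -/
def assignAll {nd ns : ℕ} (ic : Fin ns → Fin nd) (s : Fin ns → ℝ) (i : Fin nd) (j : Fin ns) : ℝ :=
  if i = ic j then s j else 0

theorem assignAll_nonneg {nd ns : ℕ} (ic : Fin ns → Fin nd) {s : Fin ns → ℝ}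
    (hs : ∀ j, 0 ≤ s j) (i : Fin nd) (j : Fin ns) : 0 ≤ assignAll ic s i j := by
  unfold assignAll
  split_ifs
  exacts [hs j, le_rfl]

theorem sum_assignAll_le {nd ns : ℕ} (ic : Fin ns → Fin nd) {s : Fin ns → ℝ}
    (hs : ∀ j, 0 ≤ s j) (i : Fin nd) : ∑ j, assignAll ic s i j ≤ ∑ j, s j := by
  refine Finset.sum_le_sum fun j _ => ?_
  unfold assignAll
  split_ifs
  exacts [le_rfl, hs j]

theorem sum_assignAll {nd ns : ℕ} (ic : Fin ns → Fin nd) (s : Fin ns → ℝ) (j : Fin ns) :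
    ∑ i, assignAll ic s i j = s j := by
  simp [assignAll]

theorem sum_mul_assignAll {nd ns : ℕ} (ic : Fin ns → Fin nd) (s : Fin ns → ℝ)
    (w : Fin nd → Fin ns → ℝ) :
    ∑ i, ∑ j, w i j * assignAll ic s i j = ∑ j, w (ic j) j * s j := by
  rw [Finset.sum_comm]
  simp [assignAll]

/-- If supply is scarce relative to every control demand and the best control weight dominates,
all supply is optimally matched to control. -/
theorem PhiCI_eq_of_control {nd ns : ℕ} {v vtre : Fin nd → Fin ns → ℝ}
    {dcon dtre : Fin nd → ℝ} {s : Fin ns → ℝ} (ic : Fin ns → Fin nd)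
    (hs : ∀ j, 0 ≤ s j) (hd : ∀ i, ∑ j, s j ≤ dcon i) (hdtre : ∀ i, 0 ≤ dtre i)
    (hb : ∀ j, 0 ≤ v (ic j) j) (hv : ∀ i j, v i j ≤ v (ic j) j)
    (hvtre : ∀ i j, vtre i j ≤ v (ic j) j) :
    PhiCI v vtre dcon dtre s = ∑ j, v (ic j) j * s j := by
  refine PhiCI_eq_of_attained (xcon := assignAll ic s) (xtre := fun _ _ => 0)
    ⟨assignAll_nonneg ic hs, fun _ _ => le_rfl,
      fun i => (sum_assignAll_le ic hs i).trans (hd i), fun i => by simpa using hdtre i,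
      fun j => by simp [sum_assignAll]⟩ hb hv hvtre ?_
  simpa using sum_mul_assignAll ic s v

theorem CIfeasible.swap {nd ns : ℕ} {dcon dtre : Fin nd → ℝ} {s : Fin ns → ℝ}
    {xcon xtre : Fin nd → Fin ns → ℝ} (h : CIfeasible dcon dtre s xcon xtre) :
    CIfeasible dtre dcon s xtre xcon :=
  ⟨h.2.1, h.1, h.2.2.2.1, h.2.2.1, fun j => by simpa only [add_comm] using h.2.2.2.2 j⟩

/-- Exchanging the roles of control and treatment does not change the value. -/
theorem PhiCI_swap {nd ns : ℕ} (v vtre : Fin nd → Fin ns → ℝ) (dcon dtre : Fin nd → ℝ)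
    (s : Fin ns → ℝ) : PhiCI v vtre dcon dtre s = PhiCI vtre v dtre dcon s := by
  unfold PhiCI
  congr 1
  ext z
  constructor <;> rintro ⟨x, y, h, rfl⟩ <;>
    exact ⟨y, x, h.swap, by simp only [add_comm]⟩

/-- With no control demand, the control weights do not affect the value. -/
theorem PhiCI_congr_of_control_zero {nd ns : ℕ} (v w vtre : Fin nd → Fin ns → ℝ)
    (dtre : Fin nd → ℝ) (s : Fin ns → ℝ) :
    PhiCI v vtre (fun _ => 0) dtre s = PhiCI w vtre (fun _ => 0) dtre s := by
  have hzero : ∀ {x y : Fin nd → Fin ns → ℝ}, CIfeasible (fun _ => 0) dtre s x y →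
      ∀ i j, x i j = 0 := fun {x y} h i j =>
    le_antisymm ((Finset.single_le_sum (fun k _ => h.1 i k) (Finset.mem_univ j)).trans
      (h.2.2.1 i)) (h.1 i j)
  unfold PhiCI
  congr 1
  ext z
  constructor <;> rintro ⟨x, y, h, rfl⟩ <;>
    exact ⟨x, y, h, by simp only [hzero h, mul_zero]⟩

/-- in the low-supply regime with proportional cost, the fluid
cost-included RCT estimator is negatively biased, with explicit bias and
relative bias `1 - 1/(α(1-ρ))`. -/
theorem rct_ci_low_supply_bias (nd ns : ℕ) (hnd : 0 < nd) (hns : 0 < ns)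
    (v vtre : Fin nd → Fin ns → ℝ) (hv : ∀ i j, 0 < v i j)
    (alpha : ℝ) (halpha0 : 0 < alpha) (halpha1 : alpha < 1)
    (hvtre : ∀ i j, vtre i j = (1 - alpha) * v i j)
    (ic : Fin ns → Fin nd)
    (hic : ∀ j, ∀ k, k ≠ ic j → v k j < v (ic j) j)
    (lam beta : Fin nd → ℝ) (gam : Fin ns → ℝ)
    (hlam : ∀ i, 0 < lam i) (hbeta : ∀ i, 0 ≤ beta i) (hgam : ∀ j, 0 ≤ gam j)
    (rho : ℝ) (hrho0 : 0 < rho) (hrho1 : rho < 1)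
    (hlow : ∀ i, ∑ j, gam j < (1 - rho) * lam i)
    (xcon xtre : Fin nd → Fin ns → ℝ)
    (hopt : CIOptimal v vtre (fun i => (1 - rho) * lam i)
      (fun i => rho * (lam i + beta i)) gam xcon xtre)
    (hatDelta Delta : ℝ)
    (hhat : hatDelta = (1 / rho) * (∑ i, ∑ j, (1 - alpha) * v i j * xtre i j)
      - (1 / (1 - rho)) * (∑ i, ∑ j, v i j * xcon i j))
    (hDelta : Delta = PhiCI v vtre (fun _ => 0) (fun i => lam i + beta i) gam
      - PhiCI v vtre lam (fun _ => 0) gam) :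
    Delta = -alpha * ∑ j, v (ic j) j * gam j ∧
    hatDelta = -(1 / (1 - rho)) * ∑ j, v (ic j) j * gam j ∧
    hatDelta - Delta = -(1 / (1 - rho) - alpha) * ∑ j, v (ic j) j * gam j ∧
    hatDelta - Delta ≤ 0 ∧
    (0 < ∑ j, v (ic j) j * gam j →
      (hatDelta - Delta) / |Delta| = 1 - 1 / (alpha * (1 - rho))) := by
  have hle : ∀ i j, v i j ≤ v (ic j) j := fun i j => by
    rcases eq_or_ne i (ic j) with h | h
    · rw [h]
    · exact (hic j i h).le
  have hb : ∀ j, 0 ≤ v (ic j) j := fun j => (hv _ j).le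
  have hvtre_le : ∀ i j, vtre i j ≤ v i j := fun i j => by
    rw [hvtre]
    nlinarith [hv i j]
  have hvtre_le' : ∀ i j, vtre i j ≤ v (ic j) j := fun i j => (hvtre_le i j).trans (hle i j)
  have hsupply : ∀ i, ∑ j, gam j ≤ lam i := fun i => by nlinarith [hlow i, hlam i]
  have hcontrol : PhiCI v vtre lam (fun _ => 0) gam = ∑ j, v (ic j) j * gam j :=
    PhiCI_eq_of_control ic hgam hsupply (fun _ => le_rfl) hb hle hvtre_le'
  have hrct : PhiCI v vtre (fun i => (1 - rho) * lam i) (fun i => rho * (lam i + beta i)) gam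
      = ∑ j, v (ic j) j * gam j :=
    PhiCI_eq_of_control ic hgam (fun i => (hlow i).le)
      (fun i => mul_nonneg hrho0.le (add_nonneg (hlam i).le (hbeta i))) hb hle hvtre_le'
  have htreat : PhiCI v vtre (fun _ => 0) (fun i => lam i + beta i) gam
      = (1 - alpha) * ∑ j, v (ic j) j * gam j := by
    rw [PhiCI_congr_of_control_zero v vtre, PhiCI_swap]
    have hmono : ∀ i j, vtre i j ≤ vtre (ic j) j := fun i j => by
      rw [hvtre, hvtre]
      exact mul_le_mul_of_nonneg_left (hle i j) (by linarith)
    rw [PhiCI_eq_of_control ic hgam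
      (fun i => (hsupply i).trans (le_add_of_nonneg_right (hbeta i))) (fun _ => le_rfl)
      (fun j => by rw [hvtre]; exact mul_nonneg (by linarith) (hb j)) hmono hmono,
      Finset.mul_sum]
    exact Finset.sum_congr rfl fun j _ => by rw [hvtre, mul_assoc]
  obtain ⟨hfeas, hval⟩ := hopt
  have hbound := hfeas.value_le hb hle hle
  rw [hrct] at hval
  simp only [hvtre, mul_assoc, Finset.sum_add_distrib, ← Finset.mul_sum] at hval hbound hhat
  have htre_nonneg : 0 ≤ ∑ i, ∑ j, v i j * xtre i j :=
    Finset.sum_nonneg fun i _ => Finset.sum_nonneg fun j _ =>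
      mul_nonneg (hv i j).le (hfeas.2.1 i j)
  have htre_zero : ∑ i, ∑ j, v i j * xtre i j = 0 := by nlinarith
  have hS : 0 ≤ ∑ j, v (ic j) j * gam j :=
    Finset.sum_nonneg fun j _ => mul_nonneg (hb j) (hgam j)
  rw [htre_zero, mul_zero, add_zero] at hval
  rw [htre_zero, hval] at hhat
  rw [htreat, hcontrol] at hDelta
  generalize ∑ j, v (ic j) j * gam j = S at *
  have hrho : 0 < 1 - rho := by linarith
  have hDelta' : Delta = -alpha * S := by rw [hDelta]; ring
  have hhat' : hatDelta = -(1 / (1 - rho)) * S := by rw [hhat]; ring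
  have hbias : hatDelta - Delta = -(1 / (1 - rho) - alpha) * S := by rw [hDelta', hhat']; ring
  have hone : 1 ≤ 1 / (1 - rho) := (one_le_div hrho).2 (by linarith)
  refine ⟨hDelta', hhat', hbias, by rw [hbias]; nlinarith, fun hpos => ?_⟩
  have habs : |Delta| = alpha * S := by
    rw [hDelta', neg_mul, abs_neg, abs_of_pos (mul_pos halpha0 hpos)]
  rw [hbias, habs]
  field_simp
  ring
end
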